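/- Fix constants c1 > 0, M > 0 and ζ ∈ (0,1). There exist constants C > 0 and τ > 0 (depending only on c1, ζ and M) such that for all n, p, s with 2 < s ≤ ζ·p and log p ≤ M·n, the Gaussian-design minimax expected number of false positives satisfies inf_{β̂ ∈ Ω_o(c1)} sup_{β ∈ B(p,s)} E_β E_X[FP(β̂)] ≥ C·s·(s/p)^τ − s^{−1/8}. Moreover, if c1 > 2, s/p → 0 and (log p)/n → 0, this lower bound holds asymptotically for any τ > c1/2 − 1. -/

import Mathlib

open MeasureTheory ProbabilityTheory Filter
open scoped ENNReal

/-- Gaussian random-design regression model: the joint law of `(X, y)` where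
`X ∈ ℝ^{n×p}` has i.i.d. `N(0,1)` entries, `ε ~ N(0, I_n)` is independent of
`X`, and `y = Xβ + ε`. -/
noncomputable def gaussDesign (n p : ℕ) (β : Fin p → ℝ) :
    Measure ((Fin n → Fin p → ℝ) × (Fin n → ℝ)) :=
  ((Measure.pi fun _ : Fin n => Measure.pi fun _ : Fin p => gaussianReal 0 1).prod
      (Measure.pi fun _ : Fin n => gaussianReal 0 1)).map
    fun Xe => (Xe.1, fun i => (∑ j, Xe.1 i j * β j) + Xe.2 i)

/-- `B(p,s)`: vectors in `ℝ^p` with at most `s` nonzero coordinates. -/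
def SparseV (p s : ℕ) : Set (Fin p → ℝ) := {β | {j | β j ≠ 0}.ncard ≤ s}

/-- Number of false positives of the estimate `b` when the truth is `β`. -/
noncomputable def FPc {p : ℕ} (b β : Fin p → ℝ) : ℕ :=
  {j | b j ≠ 0 ∧ β j = 0}.ncard

/-- Number of true positives of the estimate `b` when the truth is `β`. -/
noncomputable def TPc {p : ℕ} (b β : Fin p → ℝ) : ℕ :=
  {j | b j ≠ 0 ∧ β j ≠ 0}.ncard

/-- Expected number of false positives `E_β E_X[FP(β̂)]`. -/
noncomputable def expFPg (n p : ℕ)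
    (bh : (Fin n → Fin p → ℝ) × (Fin n → ℝ) → Fin p → ℝ) (β : Fin p → ℝ) : ℝ≥0∞ :=
  ∫⁻ w, (FPc (bh w) β : ℝ≥0∞) ∂(gaussDesign n p β)

/-- `L²` risk `E_β E_X ‖β̂ − β‖²`. -/
noncomputable def l2riskg (n p : ℕ)
    (bh : (Fin n → Fin p → ℝ) × (Fin n → ℝ) → Fin p → ℝ) (β : Fin p → ℝ) : ℝ≥0∞ :=
  ∫⁻ w, ENNReal.ofReal (∑ j, (bh w j - β j) ^ 2) ∂(gaussDesign n p β)

/-- Membership in `Ω_o(c1)` for the Gaussian-design model: a measurable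
estimator whose worst-case risk over `B(p,s)` is at most `c1·s·log(p/s)/n`. -/
def RateMinimaxG (n p s : ℕ) (c1 : ℝ)
    (bh : (Fin n → Fin p → ℝ) × (Fin n → ℝ) → Fin p → ℝ) : Prop :=
  Measurable bh ∧
    ∀ β ∈ SparseV p s,
      l2riskg n p bh β ≤ ENNReal.ofReal (c1 * s * Real.log ((p : ℝ) / s) / n)

theorem lintegral_pi_prod_eq_prod_lintegral {ι : Type*} [Fintype ι] {α : ι → Type*}
    [∀ i, MeasurableSpace (α i)] (μ : ∀ i, Measure (α i)) [∀ i, IsProbabilityMeasure (μ i)]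
    (f : ∀ i, α i → ℝ≥0∞) (hf : ∀ i, Measurable (f i)) :
    ∫⁻ x, ∏ i, f i (x i) ∂(Measure.pi μ) = ∏ i, ∫⁻ x, f i x ∂(μ i) := by
  have hind : iIndepFun (fun i (x : ∀ i, α i) => f i (x i)) (Measure.pi μ) :=
    iIndepFun_pi fun i => (hf i).aemeasurable
  have h := lintegral_prod_eq_prod_lintegral_of_indepFun Finset.univ _ hind
    (fun i => (hf i).comp (measurable_pi_apply i))
  rw [h]
  refine Finset.prod_congr rfl fun i _ => ?_
  exact (measurePreserving_eval μ i).lintegral_comp (hf i)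

theorem gaussianReal_eq_withDensity_exp (v : ℝ) :
    gaussianReal v 1 =
      (gaussianReal 0 1).withDensity fun x => ENNReal.ofReal (Real.exp (v * x - v ^ 2 / 2)) := by
  rw [gaussianReal_of_var_ne_zero _ one_ne_zero, gaussianReal_of_var_ne_zero _ one_ne_zero,
    ← withDensity_mul _ (measurable_gaussianPDF 0 1) (by fun_prop)]
  congr 1
  ext x
  rw [Pi.mul_apply, gaussianPDF, gaussianPDF,
    ← ENNReal.ofReal_mul (gaussianPDFReal_nonneg 0 1 x), gaussianPDFReal, gaussianPDFReal,
    mul_assoc _ (Real.exp _), ← Real.exp_add]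
  congr 3
  push_cast
  ring

/-- The Cameron–Martin formula for the standard Gaussian on `ι → ℝ`. -/
theorem map_add_pi_gaussianReal {ι : Type*} [Fintype ι] (v : ι → ℝ) :
    (Measure.pi fun _ : ι => gaussianReal 0 1).map (fun x => x + v) =
      (Measure.pi fun _ : ι => gaussianReal 0 1).withDensity
        fun x => ENNReal.ofReal (Real.exp (∑ i, (v i * x i - v i ^ 2 / 2))) := by
  have h1 : (Measure.pi fun _ : ι => gaussianReal 0 1).map (fun x => x + v) =
      Measure.pi fun i => gaussianReal (v i) 1 := by
    have := Measure.pi_map_pi (μ := fun _ : ι => gaussianReal 0 1) (f := fun i x => x + v i)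
      (fun i => by fun_prop)
    simp only [gaussianReal_map_add_const, zero_add] at this
    exact this
  rw [h1]
  refine Measure.pi_eq fun s hs => ?_
  rw [withDensity_apply _ (MeasurableSet.univ_pi hs),
    ← lintegral_indicator (MeasurableSet.univ_pi hs)]
  simp_rw [gaussianReal_eq_withDensity_exp (v _)]
  have h2 : ∀ i, (gaussianReal 0 1).withDensity
      (fun x => ENNReal.ofReal (Real.exp (v i * x - v i ^ 2 / 2))) (s i) =
      ∫⁻ x, (s i).indicator
        (fun x => ENNReal.ofReal (Real.exp (v i * x - v i ^ 2 / 2))) x ∂(gaussianReal 0 1) := by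
    intro i
    rw [withDensity_apply _ (hs i), lintegral_indicator (hs i)]
  simp_rw [h2]
  rw [← lintegral_pi_prod_eq_prod_lintegral (fun _ : ι => gaussianReal 0 1) _
    fun i => Measurable.indicator (by fun_prop) (hs i)]
  refine lintegral_congr fun x => ?_
  by_cases hx : x ∈ Set.univ.pi s
  · rw [Set.indicator_of_mem hx, Real.exp_sum,
      ENNReal.ofReal_prod_of_nonneg fun i _ => (Real.exp_pos _).le]
    refine Finset.prod_congr rfl fun i _ => ?_
    rw [Set.indicator_of_mem (hx i trivial)]
  · rw [Set.indicator_of_notMem hx]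
    simp only [Set.mem_pi, Set.mem_univ, true_imp_iff, not_forall] at hx
    obtain ⟨i, hi⟩ := hx
    exact (Finset.prod_eq_zero (Finset.mem_univ i) (Set.indicator_of_notMem hi _)).symm

/-- Shifting a standard Gaussian by `v` increases the probability of an event by a factor at
most `exp lam`, up to the probability that the log-likelihood ratio exceeds `lam`. -/
theorem pi_gaussianReal_shift_le {ι : Type*} [Fintype ι] (v : ι → ℝ) (lam : ℝ)
    {A : Set (ι → ℝ)} (hA : MeasurableSet A) :
    (Measure.pi fun _ : ι => gaussianReal 0 1) {x | x + v ∈ A} ≤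
      ENNReal.ofReal (Real.exp lam) * (Measure.pi fun _ : ι => gaussianReal 0 1) A +
      (Measure.pi fun _ : ι => gaussianReal 0 1) {x | lam < ∑ i, (v i * x i + v i ^ 2 / 2)} := by
  set P := Measure.pi fun _ : ι => gaussianReal 0 1
  set B : Set (ι → ℝ) := {x | ∑ i, (v i * x i - v i ^ 2 / 2) ≤ lam}
  have hB : MeasurableSet B := measurableSet_le (by fun_prop) measurable_const
  have hsub : {x | x + v ∈ A} ⊆ (fun x => x + v) ⁻¹' (A ∩ B) ∪
      {x | lam < ∑ i, (v i * x i + v i ^ 2 / 2)} := by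
    intro x hx
    by_cases h : lam < ∑ i, (v i * x i + v i ^ 2 / 2)
    · exact Or.inr h
    · refine Or.inl ⟨hx, ?_⟩
      rw [not_lt] at h
      refine le_of_eq_of_le (Finset.sum_congr rfl fun i _ => ?_) h
      simp only [Pi.add_apply]
      ring
  refine (measure_mono hsub).trans ((measure_union_le _ _).trans (add_le_add_left ?_ _))
  rw [← Measure.map_apply (by fun_prop) (hA.inter hB), map_add_pi_gaussianReal,
    withDensity_apply _ (hA.inter hB)]
  calc ∫⁻ x in A ∩ B, ENNReal.ofReal (Real.exp (∑ i, (v i * x i - v i ^ 2 / 2))) ∂P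
      ≤ ∫⁻ _ in A ∩ B, ENNReal.ofReal (Real.exp lam) ∂P :=
        setLIntegral_mono measurable_const fun x hx =>
          ENNReal.ofReal_le_ofReal (Real.exp_le_exp.2 hx.2)
    _ ≤ _ := by
        rw [setLIntegral_const]
        gcongr
        exact Set.inter_subset_left

theorem integrable_pow_gaussianReal (k : ℕ) :
    Integrable (fun x : ℝ => x ^ k) (gaussianReal 0 1) := by
  have h := (memLp_id_gaussianReal (μ := 0) (v := 1) k).integrable_norm_pow'
  refine h.mono' (by fun_prop) (ae_of_all _ fun x => ?_)
  simp

theorem integral_sq_gaussianReal : ∫ x, x ^ 2 ∂(gaussianReal 0 1) = 1 := by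
  have h := variance_fun_id_gaussianReal (μ := 0) (v := 1)
  rw [variance_eq_sub (X := fun x => x) (memLp_id_gaussianReal' 2 (by simp)),
    integral_id_gaussianReal] at h
  simpa using h

/-- The contribution of one observation to the log-likelihood ratio of two regression models
that differ by `m` in one coordinate, where `z.1` is the covariate and `z.2` the noise. -/
noncomputable def logRatioTerm (m : ℝ) (z : ℝ × ℝ) : ℝ := m * z.1 * z.2 + (m * z.1) ^ 2 / 2

theorem integrable_mul_pow_gaussianReal (a b : ℕ) :
    Integrable (fun z : ℝ × ℝ => z.1 ^ a * z.2 ^ b)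
      ((gaussianReal 0 1).prod (gaussianReal 0 1)) :=
  (integrable_pow_gaussianReal a).mul_prod (integrable_pow_gaussianReal b)

theorem integral_mul_pow_gaussianReal (a b : ℕ) :
    ∫ z : ℝ × ℝ, z.1 ^ a * z.2 ^ b ∂((gaussianReal 0 1).prod (gaussianReal 0 1)) =
      (∫ x, x ^ a ∂(gaussianReal 0 1)) * ∫ x, x ^ b ∂(gaussianReal 0 1) :=
  integral_prod_mul (fun x : ℝ => x ^ a) (fun x : ℝ => x ^ b)

theorem logRatioTerm_eq (m : ℝ) : logRatioTerm m =
    fun z => m * (z.1 ^ 1 * z.2 ^ 1) + m ^ 2 / 2 * (z.1 ^ 2 * z.2 ^ 0) := by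
  ext z
  simp only [logRatioTerm]
  ring

theorem logRatioTerm_sq_eq (m : ℝ) : (fun z => logRatioTerm m z ^ 2) =
    fun z => m ^ 2 * (z.1 ^ 2 * z.2 ^ 2) + (m ^ 3 * (z.1 ^ 3 * z.2 ^ 1) +
      m ^ 4 / 4 * (z.1 ^ 4 * z.2 ^ 0)) := by
  ext z
  simp only [logRatioTerm]
  ring

theorem measurable_logRatioTerm (m : ℝ) : Measurable (logRatioTerm m) := by
  unfold logRatioTerm
  fun_prop

theorem memLp_logRatioTerm (m : ℝ) :
    MemLp (logRatioTerm m) 2 ((gaussianReal 0 1).prod (gaussianReal 0 1)) := by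
  rw [memLp_two_iff_integrable_sq (measurable_logRatioTerm m).aestronglyMeasurable,
    logRatioTerm_sq_eq]
  exact ((integrable_mul_pow_gaussianReal 2 2).const_mul _).add
    (((integrable_mul_pow_gaussianReal 3 1).const_mul _).add
      ((integrable_mul_pow_gaussianReal 4 0).const_mul _))

theorem integral_logRatioTerm (m : ℝ) :
    ∫ z, logRatioTerm m z ∂((gaussianReal 0 1).prod (gaussianReal 0 1)) = m ^ 2 / 2 := by
  rw [logRatioTerm_eq, integral_add ((integrable_mul_pow_gaussianReal 1 1).const_mul _)
    ((integrable_mul_pow_gaussianReal 2 0).const_mul _), integral_const_mul, integral_const_mul,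
    integral_mul_pow_gaussianReal, integral_mul_pow_gaussianReal, integral_sq_gaussianReal]
  simp [integral_id_gaussianReal]

theorem variance_logRatioTerm_le (m : ℝ) :
    Var[logRatioTerm m; (gaussianReal 0 1).prod (gaussianReal 0 1)] ≤
      m ^ 2 * (1 + (∫ x, x ^ 4 ∂(gaussianReal 0 1)) / 4 * m ^ 2) := by
  refine (variance_le_expectation_sq
    (measurable_logRatioTerm m).aestronglyMeasurable).trans_eq ?_
  have h2 := (integrable_mul_pow_gaussianReal 2 2).const_mul (m ^ 2)
  have h3 := (integrable_mul_pow_gaussianReal 3 1).const_mul (m ^ 3)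
  have h4 := (integrable_mul_pow_gaussianReal 4 0).const_mul (m ^ 4 / 4)
  change ∫ z, logRatioTerm m z ^ 2 ∂_ = _
  rw [logRatioTerm_sq_eq, integral_add h2 (by exact h3.add h4), integral_add h3 h4, integral_const_mul,
    integral_const_mul, integral_const_mul, integral_mul_pow_gaussianReal,
    integral_mul_pow_gaussianReal, integral_mul_pow_gaussianReal, integral_sq_gaussianReal]
  simp [integral_id_gaussianReal]
  ring

/-- Chebyshev's inequality for the log-likelihood ratio of two regression models that differ
by `m` in one coordinate. -/
theorem measure_logRatio_gt_le (n p : ℕ) (j : Fin p) {m t η : ℝ} (ht : 0 < t)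
    (hη : n * (m ^ 2 * (1 + (∫ x, x ^ 4 ∂(gaussianReal 0 1)) / 4 * m ^ 2)) ≤ η * t ^ 2) :
    ((Measure.pi fun _ : Fin n => Measure.pi fun _ : Fin p => gaussianReal 0 1).prod
      (Measure.pi fun _ : Fin n => gaussianReal 0 1))
      {Xe | n * m ^ 2 / 2 + t < ∑ i, logRatioTerm m (Xe.1 i j, Xe.2 i)} ≤ ENNReal.ofReal η := by
  set γ := gaussianReal 0 1
  let Q := Measure.pi fun _ : Fin n => γ.prod γ
  let S : (Fin n → ℝ × ℝ) → ℝ := ∑ i, fun z => logRatioTerm m (z i)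
  have hcol : MeasurePreserving (fun (X : Fin n → Fin p → ℝ) i => X i j)
      (Measure.pi fun _ : Fin n => Measure.pi fun _ : Fin p => γ) (Measure.pi fun _ : Fin n => γ) :=
    measurePreserving_pi _ _ fun _ => measurePreserving_eval (fun _ : Fin p => γ) j
  have hpair : MeasurePreserving
      (fun (Xe : (Fin n → Fin p → ℝ) × (Fin n → ℝ)) (i : Fin n) => (Xe.1 i j, Xe.2 i))
      ((Measure.pi fun _ : Fin n => Measure.pi fun _ : Fin p => γ).prod
        (Measure.pi fun _ : Fin n => γ)) Q :=
    ((measurePreserving_arrowProdEquivProdArrow ℝ ℝ (Fin n) (fun _ => γ) fun _ => γ).symm).comp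
      (hcol.prod (MeasurePreserving.id _))
  have hSm : MemLp S 2 Q := memLp_finsetSum' _ fun i _ =>
    (memLp_logRatioTerm m).comp_measurePreserving (measurePreserving_eval _ i)
  have hSmeas : Measurable S := by
    have := measurable_logRatioTerm m
    unfold S
    fun_prop
  have hmean : ∫ z, S z ∂Q = n * m ^ 2 / 2 := by
    simp only [S, Finset.sum_apply]
    rw [integral_finsetSum _ fun i _ => by
      exact ((memLp_logRatioTerm m).comp_measurePreserving
        (measurePreserving_eval (fun _ : Fin n => γ.prod γ) i)).integrable one_le_two]
    have : ∀ i : Fin n, ∫ z, logRatioTerm m (z i) ∂Q = m ^ 2 / 2 := fun i => by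
      rw [← integral_logRatioTerm m]
      exact integral_comp_eval (μ := fun _ : Fin n => γ.prod γ) (i := i)
        (measurable_logRatioTerm m).aestronglyMeasurable
    simp only [this, Finset.sum_const, Finset.card_univ, Fintype.card_fin, nsmul_eq_mul]
    ring
  have hvar : Var[S; Q] ≤ η * t ^ 2 := by
    refine le_trans ?_ hη
    rw [variance_sum_pi fun _ => memLp_logRatioTerm m]
    simp only [Finset.sum_const, Finset.card_univ, Fintype.card_fin, nsmul_eq_mul]
    exact mul_le_mul_of_nonneg_left (variance_logRatioTerm_le m) n.cast_nonneg
  have hcheb := meas_ge_le_variance_div_sq hSm ht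
  rw [hmean] at hcheb
  have hmeas : MeasurableSet {z | n * m ^ 2 / 2 + t < S z} :=
    measurableSet_lt measurable_const hSmeas
  have hpre := hpair.measure_preimage hmeas.nullMeasurableSet
  have heq : (fun (Xe : (Fin n → Fin p → ℝ) × (Fin n → ℝ)) (i : Fin n) => (Xe.1 i j, Xe.2 i)) ⁻¹'
      {z | n * m ^ 2 / 2 + t < S z} =
      {Xe | n * m ^ 2 / 2 + t < ∑ i, logRatioTerm m (Xe.1 i j, Xe.2 i)} := by
    ext Xe
    simp [S]
  rw [← heq, hpre]
  refine (measure_mono fun z hz => ?_).trans (hcheb.trans (ENNReal.ofReal_le_ofReal ?_))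
  · have hz' : n * m ^ 2 / 2 + t < S z := hz
    exact le_trans (le_sub_iff_add_le'.2 hz'.le) (le_abs_self _)
  · rwa [div_le_iff₀ (by positivity)]

/-- The vector equal to `m` on `T` and to `0` elsewhere. -/
noncomputable def spike {p : ℕ} (m : ℝ) (T : Finset (Fin p)) : Fin p → ℝ :=
  fun j => if j ∈ T then m else 0

theorem spike_mem_sparseV {p s : ℕ} (m : ℝ) {T : Finset (Fin p)} (hT : T.card ≤ s) :
    spike m T ∈ SparseV p s := by
  refine le_trans (le_trans (Set.ncard_le_ncard (fun j hj => ?_) T.finite_toSet)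
    (Set.ncard_coe_finset T).le) hT
  by_contra h
  exact hj (if_neg h)

theorem sum_mul_spike_insert {p : ℕ} (m : ℝ) {T : Finset (Fin p)} {j : Fin p} (hj : j ∉ T)
    (x : Fin p → ℝ) :
    ∑ k, x k * spike m (insert j T) k = ∑ k, x k * spike m T k + m * x j := by
  simp only [spike, mul_ite, mul_zero, Finset.sum_ite_mem, Finset.univ_inter, Finset.sum_insert hj]
  ring

theorem measurable_gaussDesign_map (n p : ℕ) (β : Fin p → ℝ) :
    Measurable fun Xe : (Fin n → Fin p → ℝ) × (Fin n → ℝ) =>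
      (Xe.1, fun i => (∑ j, Xe.1 i j * β j) + Xe.2 i) := by
  fun_prop

instance isProbabilityMeasure_gaussDesign (n p : ℕ) (β : Fin p → ℝ) :
    IsProbabilityMeasure (gaussDesign n p β) :=
  Measure.isProbabilityMeasure_map (measurable_gaussDesign_map n p β).aemeasurable

theorem gaussDesign_apply (n p : ℕ) (β : Fin p → ℝ)
    {E : Set ((Fin n → Fin p → ℝ) × (Fin n → ℝ))} (hE : MeasurableSet E) :
    gaussDesign n p β E = ∫⁻ X, (Measure.pi fun _ : Fin n => gaussianReal 0 1)
      {e | (X, fun i => (∑ j, X i j * β j) + e i) ∈ E}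
      ∂(Measure.pi fun _ : Fin n => Measure.pi fun _ : Fin p => gaussianReal 0 1) := by
  rw [gaussDesign, Measure.map_apply (measurable_gaussDesign_map n p β) hE,
    Measure.prod_apply (measurable_gaussDesign_map n p β hE)]
  rfl

/-- Adding one coordinate to the support of a spike vector increases the probability of an
event by a bounded factor, up to the tail of the log-likelihood ratio. -/
theorem gaussDesign_spike_insert_le (n p : ℕ) {T : Finset (Fin p)} {j : Fin p} (hj : j ∉ T)
    {m t lam η : ℝ} (ht : 0 < t) (hlam : n * m ^ 2 / 2 + t ≤ lam)
    (hη : n * (m ^ 2 * (1 + (∫ x, x ^ 4 ∂(gaussianReal 0 1)) / 4 * m ^ 2)) ≤ η * t ^ 2)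
    {E : Set ((Fin n → Fin p → ℝ) × (Fin n → ℝ))} (hE : MeasurableSet E) :
    gaussDesign n p (spike m (insert j T)) E ≤
      ENNReal.ofReal (Real.exp lam) * gaussDesign n p (spike m T) E + ENNReal.ofReal η := by
  let F : Set ((Fin n → Fin p → ℝ) × (Fin n → ℝ)) :=
    {Xe | lam < ∑ i, logRatioTerm m (Xe.1 i j, Xe.2 i)}
  have hF : MeasurableSet F := by
    refine measurableSet_lt measurable_const (Finset.measurable_sum _ fun i _ =>
      (measurable_logRatioTerm m).comp (by fun_prop))
  have hmeas : MeasurableSet {Xe : (Fin n → Fin p → ℝ) × (Fin n → ℝ) |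
      (Xe.1, fun i => (∑ j, Xe.1 i j * spike m T j) + Xe.2 i) ∈ E} :=
    measurable_gaussDesign_map n p (spike m T) hE
  have htail := measure_logRatio_gt_le n p j ht hη
  have htail' : _ ≤ ENNReal.ofReal η :=
    (measure_mono fun Xe (hXe : Xe ∈ F) => lt_of_le_of_lt hlam hXe).trans htail
  rw [Measure.prod_apply hF] at htail'
  rw [gaussDesign_apply n p _ hE, gaussDesign_apply n p _ hE,
    ← lintegral_const_mul _ (by exact measurable_measure_prodMk_left hmeas)]
  refine le_trans ?_ (add_le_add_right htail' _)
  rw [← lintegral_add_right _ (measurable_measure_prodMk_left hF)]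
  refine lintegral_mono fun X => ?_
  have h := pi_gaussianReal_shift_le (fun i => m * X i j) lam
    (measurable_prodMk_left (x := X) hmeas)
  refine le_trans (le_of_eq ?_) (h.trans (add_le_add_right (measure_mono ?_) _))
  · congr 1
    ext e
    simp only [Set.mem_ofPred_eq, Set.mem_preimage, sum_mul_spike_insert m hj, Pi.add_apply]
    rw [iff_iff_eq]
    congr 2
    ext i
    ring
  · intro e he
    exact he

/-- Double counting of pairs consisting of a set of size `r + 1` and one of its elements. -/
theorem sum_powersetCard_sum_insert {α M : Type*} [Fintype α] [DecidableEq α] [AddCommMonoid M]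
    (r : ℕ) (f : Finset α → α → M) :
    ∑ T ∈ Finset.powersetCard r Finset.univ, ∑ j ∈ Tᶜ, f (insert j T) j =
      ∑ S ∈ Finset.powersetCard (r + 1) Finset.univ, ∑ j ∈ S, f S j := by
  rw [Finset.sum_sigma', Finset.sum_sigma']
  refine Finset.sum_bij' (fun x _ => ⟨insert x.2 x.1, x.2⟩) (fun x _ => ⟨x.1.erase x.2, x.2⟩)
    ?_ ?_ ?_ ?_ ?_
  · rintro ⟨T, j⟩ h
    simp only [Finset.mem_sigma, Finset.mem_powersetCard_univ, Finset.mem_compl] at h ⊢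
    exact ⟨by rw [Finset.card_insert_of_notMem h.2, h.1], Finset.mem_insert_self _ _⟩
  · rintro ⟨S, j⟩ h
    simp only [Finset.mem_sigma, Finset.mem_powersetCard_univ, Finset.mem_compl] at h ⊢
    exact ⟨by rw [Finset.card_erase_of_mem h.2, h.1, Nat.add_sub_cancel],
      Finset.notMem_erase _ _⟩
  · rintro ⟨T, j⟩ h
    simp only [Finset.mem_sigma, Finset.mem_compl] at h
    simp [Finset.erase_insert h.2]
  · rintro ⟨S, j⟩ h
    simp only [Finset.mem_sigma] at h
    simp [Finset.insert_erase h.2]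
  · rintro ⟨T, j⟩ _
    rfl

theorem exists_card_eq_le_sum_compl {p r : ℕ} (hr : r < p) {ρ η K : ℝ} (hK : 0 < K)
    (q : Finset (Fin p) → Fin p → ℝ)
    (hq : ∀ S : Finset (Fin p), S.card = r + 1 → (1 - ρ) * (r + 1 : ℕ) ≤ ∑ j ∈ S, q S j)
    (hins : ∀ (T : Finset (Fin p)) (j : Fin p), j ∉ T → q (insert j T) j ≤ K * q T j + η) :
    ∃ T : Finset (Fin p), T.card = r ∧ (p - r) * K⁻¹ * (1 - ρ - η) ≤ ∑ j ∈ Tᶜ, q T j := by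
  have hne : (Finset.powersetCard r (Finset.univ : Finset (Fin p))).Nonempty :=
    Finset.powersetCard_nonempty.2 (by simpa using hr.le)
  have hcount : (p.choose (r + 1) * (r + 1 : ℕ) : ℝ) = p.choose r * (p - r) := by
    have := Nat.choose_succ_right_eq p r
    rw [← Nat.cast_sub hr.le]
    exact_mod_cast this
  have hcompl : ∀ T : Finset (Fin p), T.card = r → ((Tᶜ.card : ℕ) : ℝ) = p - r := fun T hT => by
    rw [Finset.card_compl, Fintype.card_fin, hT, Nat.cast_sub hr.le]
  have hlow : (p.choose (r + 1) : ℝ) * ((1 - ρ) * (r + 1 : ℕ)) ≤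
      ∑ T ∈ Finset.powersetCard r Finset.univ, (K * ∑ j ∈ Tᶜ, q T j + (p - r) * η) := by
    calc (p.choose (r + 1) : ℝ) * ((1 - ρ) * (r + 1 : ℕ))
        = ∑ _S ∈ Finset.powersetCard (r + 1) (Finset.univ : Finset (Fin p)),
            (1 - ρ) * (r + 1 : ℕ) := by
          rw [Finset.sum_const, Finset.card_powersetCard, Finset.card_univ, Fintype.card_fin,
            nsmul_eq_mul]
      _ ≤ ∑ S ∈ Finset.powersetCard (r + 1) Finset.univ, ∑ j ∈ S, q S j :=
          Finset.sum_le_sum fun S hS => hq S (Finset.mem_powersetCard_univ.1 hS)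
      _ = ∑ T ∈ Finset.powersetCard r Finset.univ, ∑ j ∈ Tᶜ, q (insert j T) j :=
          (sum_powersetCard_sum_insert r q).symm
      _ ≤ _ := by
          refine Finset.sum_le_sum fun T hT => ?_
          rw [← hcompl T (Finset.mem_powersetCard_univ.1 hT), Finset.mul_sum, ← nsmul_eq_mul,
            ← Finset.sum_const, ← Finset.sum_add_distrib]
          exact Finset.sum_le_sum fun j hj => hins T j (Finset.mem_compl.1 hj)
  have hconst : ∑ _T ∈ Finset.powersetCard r (Finset.univ : Finset (Fin p)),
      (p - r) * (1 - ρ) = (p.choose (r + 1) : ℝ) * ((1 - ρ) * (r + 1 : ℕ)) := by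
    rw [Finset.sum_const, Finset.card_powersetCard, Finset.card_univ, Fintype.card_fin,
      nsmul_eq_mul]
    linear_combination -(1 - ρ) * hcount
  obtain ⟨T, hT, hle⟩ := Finset.exists_le_of_sum_le hne (hconst.le.trans hlow)
  refine ⟨T, Finset.mem_powersetCard_univ.1 hT, ?_⟩
  rw [mul_right_comm, mul_inv_le_iff₀ hK]
  linarith

theorem setOf_ncard_eq_sum {p : ℕ} (P : Fin p → Prop) [DecidablePred P] :
    ({j | P j}.ncard : ℝ≥0∞) = ∑ j, if P j then 1 else 0 := by
  rw [Set.ncard_eq_toFinset_card', Finset.sum_ite]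
  simp

/-- The probability that coordinate `j` is selected by the estimator. -/
noncomputable def selectionProb (n p : ℕ) (bh : (Fin n → Fin p → ℝ) × (Fin n → ℝ) → Fin p → ℝ)
    (β : Fin p → ℝ) (j : Fin p) : ℝ :=
  (gaussDesign n p β).real {w | bh w j ≠ 0}

theorem measurableSet_selected {n p : ℕ}
    {bh : (Fin n → Fin p → ℝ) × (Fin n → ℝ) → Fin p → ℝ} (hbh : Measurable bh) (j : Fin p) :
    MeasurableSet {w | bh w j ≠ 0} :=
  ((measurable_pi_apply j).comp hbh) (measurableSet_singleton 0).compl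

theorem ofReal_sum_selectionProb_le_expFPg {n p : ℕ}
    {bh : (Fin n → Fin p → ℝ) × (Fin n → ℝ) → Fin p → ℝ} (hbh : Measurable bh) (m : ℝ)
    (T : Finset (Fin p)) :
    ENNReal.ofReal (∑ j ∈ Tᶜ, selectionProb n p bh (spike m T) j) ≤
      expFPg n p bh (spike m T) := by
  simp only [selectionProb]
  rw [ENNReal.ofReal_sum_of_nonneg fun j _ => measureReal_nonneg]
  calc ∑ j ∈ Tᶜ, ENNReal.ofReal ((gaussDesign n p (spike m T)).real {w | bh w j ≠ 0})
      = ∑ j ∈ Tᶜ, ∫⁻ w, {w | bh w j ≠ 0}.indicator 1 w ∂(gaussDesign n p (spike m T)) :=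
        Finset.sum_congr rfl fun j _ => by
          rw [ofReal_measureReal, lintegral_indicator_one (measurableSet_selected hbh j)]
    _ = ∫⁻ w, ∑ j ∈ Tᶜ, {w | bh w j ≠ 0}.indicator 1 w ∂(gaussDesign n p (spike m T)) :=
        (lintegral_finsetSum _ fun j _ =>
          measurable_one.indicator (measurableSet_selected hbh j)).symm
    _ ≤ _ := by
        classical
        refine lintegral_mono fun w => ?_
        rw [FPc, setOf_ncard_eq_sum]
        refine (Finset.sum_le_sum fun j hj => ?_).trans
          (Finset.sum_le_sum_of_subset (Finset.subset_univ Tᶜ))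
        have h0 : spike m T j = 0 := if_neg (Finset.mem_compl.1 hj)
        by_cases h : bh w j = 0 <;> simp [Set.indicator, h, h0]

/-- A risk bound forces the estimator to select most of the support of a spike vector. -/
theorem le_sum_selectionProb_of_l2riskg_le {n p : ℕ}
    {bh : (Fin n → Fin p → ℝ) × (Fin n → ℝ) → Fin p → ℝ} (hbh : Measurable bh) {m ρ : ℝ}
    (hm : 0 < m) (hρ : 0 ≤ ρ) (S : Finset (Fin p))
    (hrisk : l2riskg n p bh (spike m S) ≤ ENNReal.ofReal (ρ * S.card * m ^ 2)) :
    (1 - ρ) * S.card ≤ ∑ j ∈ S, selectionProb n p bh (spike m S) j := by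
  have hmiss : ∀ j, (gaussDesign n p (spike m S)).real {w | bh w j = 0} =
      1 - selectionProb n p bh (spike m S) j := fun j => by
    rw [selectionProb, ← probReal_compl_eq_one_sub (measurableSet_selected hbh j)]
    congr 1
    ext w
    simp
  have hmeas : ∀ j, MeasurableSet {w | bh w j = 0} := fun j =>
    ((measurable_pi_apply j).comp hbh) (measurableSet_singleton 0)
  have hle : ∑ j ∈ S, ENNReal.ofReal (m ^ 2) * gaussDesign n p (spike m S) {w | bh w j = 0} ≤
      l2riskg n p bh (spike m S) := by
    calc ∑ j ∈ S, ENNReal.ofReal (m ^ 2) * gaussDesign n p (spike m S) {w | bh w j = 0}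
        = ∑ j ∈ S, ∫⁻ w, {w | bh w j = 0}.indicator (fun _ => ENNReal.ofReal (m ^ 2)) w
            ∂(gaussDesign n p (spike m S)) :=
          Finset.sum_congr rfl fun j _ => (lintegral_indicator_const (hmeas j) _).symm
      _ = ∫⁻ w, ∑ j ∈ S, {w | bh w j = 0}.indicator (fun _ => ENNReal.ofReal (m ^ 2)) w
            ∂(gaussDesign n p (spike m S)) :=
          (lintegral_finsetSum _ fun j _ => measurable_const.indicator (hmeas j)).symm
      _ ≤ _ := by
          refine lintegral_mono fun w => ?_
          rw [ENNReal.ofReal_sum_of_nonneg fun j _ => sq_nonneg _]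
          refine (Finset.sum_le_sum fun j hj => ?_).trans
            (Finset.sum_le_sum_of_subset (Finset.subset_univ S))
          have h0 : spike m S j = m := if_pos hj
          by_cases h : bh w j = 0 <;> simp [Set.indicator, h, h0]
  have hsum : ∑ j ∈ S, ENNReal.ofReal (m ^ 2) * gaussDesign n p (spike m S) {w | bh w j = 0} =
      ENNReal.ofReal (∑ j ∈ S, m ^ 2 * (1 - selectionProb n p bh (spike m S) j)) := by
    rw [ENNReal.ofReal_sum_of_nonneg fun j _ => by rw [← hmiss]; positivity]
    refine Finset.sum_congr rfl fun j _ => ?_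
    rw [ENNReal.ofReal_mul (sq_nonneg m), ← hmiss, ofReal_measureReal]
  have hreal := (ENNReal.ofReal_le_ofReal_iff (by positivity)).1 (hsum ▸ hle.trans hrisk)
  rw [← Finset.mul_sum, Finset.sum_sub_distrib, Finset.sum_const, nsmul_eq_mul, mul_one,
    mul_comm (ρ * _)] at hreal
  have := le_of_mul_le_mul_left hreal (by positivity)
  linarith

/-- A risk bound at signal strength `m` forces many false positives. -/
theorem le_iSup_expFPg_of_risk_le {n p s : ℕ} (hs : 0 < s) (hsp : s ≤ p)
    {bh : (Fin n → Fin p → ℝ) × (Fin n → ℝ) → Fin p → ℝ} (hbh : Measurable bh)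
    {m ρ t lam η : ℝ} (hm : 0 < m) (hρ : 0 ≤ ρ) (ht : 0 < t) (hη0 : 0 ≤ η)
    (hlam : n * m ^ 2 / 2 + t ≤ lam)
    (hη : n * (m ^ 2 * (1 + (∫ x, x ^ 4 ∂(gaussianReal 0 1)) / 4 * m ^ 2)) ≤ η * t ^ 2)
    (hrisk : ∀ β ∈ SparseV p s, l2riskg n p bh β ≤ ENNReal.ofReal (ρ * s * m ^ 2)) :
    ENNReal.ofReal ((p - s + 1) * Real.exp (-lam) * (1 - ρ - η)) ≤
      ⨆ β ∈ SparseV p s, expFPg n p bh β := by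
  obtain ⟨r, rfl⟩ : ∃ r, s = r + 1 := ⟨s - 1, by omega⟩
  obtain ⟨T, hT, hle⟩ := exists_card_eq_le_sum_compl (r := r) (p := p) (by omega) (ρ := ρ) (η := η)
    (Real.exp_pos lam) (fun S j => selectionProb n p bh (spike m S) j)
    (fun S hS => by
      rw [← hS]
      exact le_sum_selectionProb_of_l2riskg_le hbh hm hρ S
        (hS ▸ hrisk _ (spike_mem_sparseV m hS.le)))
    (fun T j hj => by
      have h := gaussDesign_spike_insert_le n p hj ht hlam hη (measurableSet_selected hbh j)
      have hq : 0 ≤ Real.exp lam * (gaussDesign n p (spike m T)).real {w | bh w j ≠ 0} :=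
        mul_nonneg (Real.exp_pos _).le measureReal_nonneg
      rw [← ofReal_measureReal, ← ofReal_measureReal, ← ENNReal.ofReal_mul (Real.exp_pos _).le,
        ← ENNReal.ofReal_add hq hη0] at h
      exact (ENNReal.ofReal_le_ofReal_iff (add_nonneg hq hη0)).1 h)
  refine le_trans (ENNReal.ofReal_le_ofReal (le_of_eq_of_le ?_ hle))
    ((ofReal_sum_selectionProb_le_expFPg hbh m T).trans
      (le_iSup₂ (f := fun β _ => expFPg n p bh β) (spike m T)
        (spike_mem_sparseV m (by omega))))
  rw [Real.exp_neg]
  push_cast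
  ring

/-- The false positive lower bound for rate-minimax estimators, at the signal strength
`m ^ 2 = a * log (p / s) / n`. -/
theorem le_iSup_expFPg_of_rateMinimaxG {n p s : ℕ} (hs : 0 < s) (hsp : s < p) {c1 a b κ η : ℝ}
    {bh : (Fin n → Fin p → ℝ) × (Fin n → ℝ) → Fin p → ℝ} (hbh : RateMinimaxG n p s c1 bh)
    (hc1 : 0 < c1) (ha : 0 < a) (hb : 0 < b) (hη0 : 0 ≤ η)
    (hκ : 1 + (∫ x, x ^ 4 ∂(gaussianReal 0 1)) / 4 * (a * Real.log (p / s) / n) ≤ κ)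
    (hη : a * κ ≤ η * b ^ 2 * Real.log (p / s)) :
    ENNReal.ofReal ((p - s + 1) * ((s : ℝ) / p) ^ (a / 2 + b) * (1 - c1 / a - η)) ≤
      ⨆ β ∈ SparseV p s, expFPg n p bh β := by
  have hs' : (0 : ℝ) < s := by exact_mod_cast hs
  have hp' : (0 : ℝ) < p := by exact_mod_cast hs.trans hsp
  have hL : 0 < Real.log (p / s) :=
    Real.log_pos ((one_lt_div hs').2 (by exact_mod_cast hsp))
  set L := Real.log ((p : ℝ) / s) with hLdef
  have hexp : ((s : ℝ) / p) ^ (a / 2 + b) = Real.exp (-((a / 2 + b) * L)) := by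
    rw [Real.rpow_def_of_pos (by positivity), hLdef, ← inv_div (s : ℝ) p, Real.log_inv]
    ring_nf
  rw [hexp]
  obtain ⟨m, hm, hnm, hmκ, hrisk⟩ : ∃ m : ℝ, 0 < m ∧ n * m ^ 2 ≤ a * L ∧
      n * (m ^ 2 * (1 + (∫ x, x ^ 4 ∂(gaussianReal 0 1)) / 4 * m ^ 2)) ≤ a * L * κ ∧
      c1 * s * L / n ≤ c1 / a * s * m ^ 2 := by
    have h4 : 0 ≤ ∫ x, x ^ 4 ∂(gaussianReal 0 1) := integral_nonneg fun x => by positivity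
    rcases Nat.eq_zero_or_pos n with rfl | hn
    · have hκ0 : 0 ≤ κ := by
        simp only [Nat.cast_zero, div_zero, mul_zero, add_zero] at hκ
        linarith
      refine ⟨1, one_pos, ?_, ?_, ?_⟩ <;> simp <;> positivity
    · have hn' : (0 : ℝ) < n := by exact_mod_cast hn
      have hsq : √(a * L / n) ^ 2 = a * L / n := Real.sq_sqrt (by positivity)
      refine ⟨√(a * L / n), by positivity, ?_, ?_, ?_⟩
      · rw [hsq, mul_div_cancel₀ _ hn'.ne']
      · rw [hsq, ← mul_assoc, mul_div_cancel₀ _ hn'.ne']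
        gcongr
      · rw [hsq]
        refine le_of_eq ?_
        field_simp
  refine le_iSup_expFPg_of_risk_le hs hsp.le hbh.1 hm (by positivity) (t := b * L) (by positivity)
    hη0 (by linarith) (hmκ.trans ?_)
    fun β hβ => (hbh.2 β hβ).trans (ENNReal.ofReal_le_ofReal hrisk)
  calc a * L * κ = a * κ * L := by ring
    _ ≤ η * b ^ 2 * L * L := by gcongr
    _ = η * (b * L) ^ 2 := by ring

/-- Theorem 3 of the paper: minimax lower bound on the expected number of
false positives over rate-minimax estimators under Gaussian random design.
Part 1 (non-asymptotic): there are `C, τ > 0` depending only on `c1, ζ, M`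
such that for all `n, p, s` with `2 < s ≤ ζ p` and `log p ≤ M n`,
`inf_{β̂ ∈ Ω_o(c1)} sup_{β ∈ B(p,s)} E_β E_X[FP(β̂)] ≥ C s (s/p)^τ − s^{−1/8}`.
Part 2 (asymptotic): if `c1 > 2`, `s/p → 0` and `log p / n → 0`, the bound
holds eventually for any `τ > c1/2 − 1`. -/
theorem minimax_FP_lower_bound_gaussian_design (c1 M ζ : ℝ)
    (hc1 : 0 < c1) (hM : 0 < M) (hζ : ζ ∈ Set.Ioo (0 : ℝ) 1) :
    (∃ C > (0 : ℝ), ∃ τ > (0 : ℝ), ∀ n p s : ℕ, 2 < s → (s : ℝ) ≤ ζ * p →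
      Real.log p ≤ M * n →
      ∀ bh : (Fin n → Fin p → ℝ) × (Fin n → ℝ) → Fin p → ℝ,
        RateMinimaxG n p s c1 bh →
        ENNReal.ofReal (C * s * ((s : ℝ) / p) ^ τ - (s : ℝ) ^ (-(1 / 8 : ℝ))) ≤
          ⨆ β ∈ SparseV p s, expFPg n p bh β) ∧
    (2 < c1 → ∀ τ : ℝ, c1 / 2 - 1 < τ →
      ∀ nn pp ss : ℕ → ℕ,
        Tendsto (fun k => (ss k : ℝ) / pp k) atTop (nhds 0) →
        Tendsto (fun k => Real.log (pp k) / nn k) atTop (nhds 0) →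
        ∃ C > (0 : ℝ), ∀ᶠ k in atTop,
          ∀ bh : (Fin (nn k) → Fin (pp k) → ℝ) × (Fin (nn k) → ℝ) → Fin (pp k) → ℝ,
            RateMinimaxG (nn k) (pp k) (ss k) c1 bh →
            ENNReal.ofReal
                (C * ss k * ((ss k : ℝ) / pp k) ^ τ - (ss k : ℝ) ^ (-(1 / 8 : ℝ))) ≤
              ⨆ β ∈ SparseV (pp k) (ss k), expFPg (nn k) (pp k) bh β) := by
  have hκ0 : 0 ≤ (∫ x, x ^ 4 ∂(gaussianReal 0 1)) / 4 :=
    div_nonneg (integral_nonneg fun x => by positivity) (by norm_num)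
  set κ := (∫ x, x ^ 4 ∂(gaussianReal 0 1)) / 4
  constructor
  · obtain ⟨hζ0, hζ1⟩ := hζ
    have hL0 : 0 < -Real.log ζ := neg_pos.2 (Real.log_neg hζ0 hζ1)
    set B := 8 * c1 * (1 + κ * (2 * c1 * M))
    have hB : 0 ≤ B := by positivity
    set b := 1 + B / -Real.log ζ
    have hb1 : 1 ≤ b := le_add_of_nonneg_right (by positivity)
    have hb0 : 0 < b := one_pos.trans_le hb1
    refine ⟨(1 - ζ) / 4, by linarith, c1 + b, by positivity, ?_⟩
    intro n p s hs hsp hlog bh hbh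
    have hs' : (0 : ℝ) < s := by exact_mod_cast (by omega : 0 < s)
    have hp' : (0 : ℝ) < p := by
      by_contra h
      nlinarith [hs'.trans_le hsp]
    have hsp' : (s : ℝ) < p := by nlinarith
    have hn' : (0 : ℝ) < n := by
      have : 0 < Real.log p := Real.log_pos (by
        have : (2 : ℝ) < s := by exact_mod_cast hs
        linarith)
      exact (mul_pos_iff_of_pos_left hM).1 (this.trans_le hlog)
    have hLge : -Real.log ζ ≤ Real.log (p / s) := by
      rw [← Real.log_inv]
      refine Real.log_le_log (by positivity) ?_
      rw [le_div_iff₀ hs', inv_mul_le_iff₀ hζ0]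
      exact hsp
    have hLle : Real.log (p / s) ≤ M * n := by
      refine le_trans (Real.log_le_log (by positivity) ?_) hlog
      exact div_le_self hp'.le (by exact_mod_cast (by omega : 1 ≤ s))
    have key := le_iSup_expFPg_of_rateMinimaxG (a := 2 * c1) (b := b) (η := 1 / 4)
      (κ := 1 + κ * (2 * c1 * M)) (by omega) (by exact_mod_cast hsp') hbh hc1 (by positivity) hb0
      (by norm_num) (by
        gcongr
        rw [div_le_iff₀ hn']
        nlinarith) (by
        have h1 : B ≤ b * Real.log (p / s) := by
          calc B = B / -Real.log ζ * -Real.log ζ := (div_mul_cancel₀ _ hL0.ne').symm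
            _ ≤ b * Real.log (p / s) := by
              refine mul_le_mul ?_ hLge hL0.le hb0.le
              exact le_add_of_nonneg_left zero_le_one
        have h2 : b * Real.log (p / s) ≤ b ^ 2 * Real.log (p / s) :=
          mul_le_mul_of_nonneg_right (by nlinarith) (hL0.le.trans hLge)
        linarith)
    refine le_trans (ENNReal.ofReal_le_ofReal ?_) key
    have hr : c1 / (2 * c1) = 1 / 2 := by field_simp
    have hslack : (0 : ℝ) ≤ (s : ℝ) ^ (-(1 / 8 : ℝ)) := by positivity
    rw [hr, mul_div_cancel_left₀ _ (two_ne_zero' ℝ)]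
    have hpow : (0 : ℝ) ≤ ((s : ℝ) / p) ^ (c1 + b) := by positivity
    have hcoef : (1 - ζ) / 4 * s ≤ (p - s + 1) / 4 := by nlinarith
    have := mul_le_mul_of_nonneg_right hcoef hpow
    linarith
  · intro hc τ hτ nn pp ss hsp hlog
    set a := c1 / 2 + τ + 1
    set b := (τ + 1 - c1 / 2) / 2
    set δ := 1 - c1 / a
    have ha : c1 < a := by simp only [a]; linarith
    have ha0 : 0 < a := hc1.trans ha
    have hb0 : 0 < b := by simp only [b]; linarith
    have hab : a / 2 + b = τ + 1 := by simp only [a, b]; ring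
    have hδ : 0 < δ := sub_pos.2 ((div_lt_one ha0).2 ha)
    have hτ0 : 0 < τ := by linarith
    refine ⟨δ / 4, by positivity, ?_⟩
    set R := max 2 (Real.exp (2 * a * (1 + κ * a) / (δ * b ^ 2)))
    have hR0 : 0 < R := two_pos.trans_le (le_max_left _ _)
    filter_upwards [hsp.eventually_lt_const (inv_pos.2 hR0), hlog.eventually_lt_const one_pos]
      with k hk1 hk2 bh hbh
    rcases Nat.eq_zero_or_pos (ss k) with hs0 | hs
    · simp [hs0, Real.zero_rpow]
    rcases Nat.eq_zero_or_pos (pp k) with hp0 | hp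
    · rw [ENNReal.ofReal_of_nonpos]
      · exact zero_le
      · simp only [hp0, Nat.cast_zero, div_zero, Real.zero_rpow hτ0.ne', mul_zero, zero_sub]
        exact neg_nonpos.2 (by positivity)
    have hs' : (0 : ℝ) < ss k := by exact_mod_cast hs
    have hp' : (0 : ℝ) < pp k := by exact_mod_cast hp
    have hRp : R < pp k / ss k := by
      rw [← inv_div]
      exact (lt_inv_comm₀ (by positivity) hR0).1 hk1
    have h2s : 2 * (ss k : ℝ) < pp k :=
      (lt_div_iff₀ hs').1 ((le_max_left _ _).trans_lt hRp)
    have hL : 2 * a * (1 + κ * a) / (δ * b ^ 2) ≤ Real.log (pp k / ss k) := by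
      rw [← Real.log_exp (2 * a * (1 + κ * a) / (δ * b ^ 2))]
      exact Real.log_le_log (Real.exp_pos _) ((le_max_right _ _).trans hRp.le)
    have hLn : Real.log (pp k / ss k) / nn k ≤ 1 := by
      refine le_trans ?_ hk2.le
      gcongr
      exact div_le_self hp'.le (by exact_mod_cast hs)
    have key := le_iSup_expFPg_of_rateMinimaxG (a := a) (b := b) (η := δ / 2)
      (κ := 1 + κ * a) hs (by exact_mod_cast (by linarith : (ss k : ℝ) < pp k)) hbh hc1 ha0 hb0
      (by positivity) (by
        rw [mul_div_assoc]
        gcongr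
        exact mul_le_of_le_one_right ha0.le hLn) (by
        rw [div_le_iff₀ (by positivity)] at hL
        linarith)
    refine le_trans (ENNReal.ofReal_le_ofReal ?_) key
    have hslack : (0 : ℝ) ≤ (ss k : ℝ) ^ (-(1 / 8 : ℝ)) := by positivity
    rw [hab, Real.rpow_add_one (by positivity)]
    have hpow : (0 : ℝ) ≤ ((ss k : ℝ) / pp k) ^ τ := by positivity
    have hcoef : (ss k : ℝ) / 2 ≤ (pp k - ss k + 1) * (ss k / pp k) := by
      rw [mul_div_assoc', le_div_iff₀ hp']
      nlinarith
    calc δ / 4 * ss k * ((ss k : ℝ) / pp k) ^ τ - (ss k : ℝ) ^ (-(1 / 8 : ℝ))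
        ≤ ss k / 2 * (((ss k : ℝ) / pp k) ^ τ * (δ / 2)) := by linarith
      _ ≤ (pp k - ss k + 1) * (ss k / pp k) * (((ss k : ℝ) / pp k) ^ τ * (δ / 2)) :=
          mul_le_mul_of_nonneg_right hcoef (by positivity)
      _ = _ := by
          simp only [δ]
          ring
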